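/- Let M be a model category. Consider two cospans of fibrant objects X_a → X_b ← X_c and X'_a → X'_b ← X'_c in which the maps X_c → X_b and X'_c → X'_b are fibrations, together with a morphism of cospans (compatible maps X_a → X'_a, X_b → X'_b, X_c → X'_c) each of which is a weak equivalence. Then the induced morphism on pullbacks X_a ×_{X_b} X_c → X'_a ×_{X'_b} X'_c is a weak equivalence. -/

import Mathlib

/-!
STATEMENT 10: In a model category, given a morphism of cospans of fibrant objects
`(Xa → Xb ← Xc) ⟶ (Xa' → Xb' ← Xc')` in which the maps `Xc → Xb` and `Xc' → Xb'` are
fibrations and all three comparison maps are weak equivalences, the induced morphism on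
pullbacks is a weak equivalence.
-/

open CategoryTheory Limits

universe v u

variable (M : Type u) [Category.{v} M]

/-- `f` is a retract of `g` in the arrow category. -/
def IsRetractOfArrow {M : Type u} [Category.{v} M] {X Y X' Y' : M}
    (f : X ⟶ Y) (g : X' ⟶ Y') : Prop :=
  ∃ (iX : X ⟶ X') (iY : Y ⟶ Y') (rX : X' ⟶ X) (rY : Y' ⟶ Y),
    iX ≫ rX = 𝟙 X ∧ iY ≫ rY = 𝟙 Y ∧ iX ≫ g = f ≫ iY ∧ rX ≫ f = g ≫ rY

/-- A model category structure on a complete and cocomplete category `M`: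
classes of weak equivalences, fibrations and cofibrations satisfying the
two-out-of-three axiom, closure under retracts, the lifting axioms and the
factorization axioms. -/
structure ModelStructure (M : Type u) [Category.{v} M] [HasLimits M] [HasColimits M] where
  weakEquivalence : MorphismProperty M
  fibration : MorphismProperty M
  cofibration : MorphismProperty M
  weakEquivalence_id : ∀ (X : M), weakEquivalence (𝟙 X)
  two_of_three_comp : ∀ {X Y Z : M} (f : X ⟶ Y) (g : Y ⟶ Z),
    weakEquivalence f → weakEquivalence g → weakEquivalence (f ≫ g)
  two_of_three_left : ∀ {X Y Z : M} (f : X ⟶ Y) (g : Y ⟶ Z),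
    weakEquivalence g → weakEquivalence (f ≫ g) → weakEquivalence f
  two_of_three_right : ∀ {X Y Z : M} (f : X ⟶ Y) (g : Y ⟶ Z),
    weakEquivalence f → weakEquivalence (f ≫ g) → weakEquivalence g
  weakEquivalence_retract : ∀ {X Y X' Y' : M} (f : X ⟶ Y) (g : X' ⟶ Y'),
    IsRetractOfArrow f g → weakEquivalence g → weakEquivalence f
  fibration_retract : ∀ {X Y X' Y' : M} (f : X ⟶ Y) (g : X' ⟶ Y'),
    IsRetractOfArrow f g → fibration g → fibration f
  cofibration_retract : ∀ {X Y X' Y' : M} (f : X ⟶ Y) (g : X' ⟶ Y'),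
    IsRetractOfArrow f g → cofibration g → cofibration f
  lifting_trivCof_fib : ∀ {A B X Y : M} (i : A ⟶ B) (p : X ⟶ Y),
    cofibration i → weakEquivalence i → fibration p → HasLiftingProperty i p
  lifting_cof_trivFib : ∀ {A B X Y : M} (i : A ⟶ B) (p : X ⟶ Y),
    cofibration i → fibration p → weakEquivalence p → HasLiftingProperty i p
  factorization_cof_trivFib : ∀ {X Y : M} (f : X ⟶ Y),
    ∃ (Z : M) (i : X ⟶ Z) (p : Z ⟶ Y),
      i ≫ p = f ∧ cofibration i ∧ fibration p ∧ weakEquivalence p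
  factorization_trivCof_fib : ∀ {X Y : M} (f : X ⟶ Y),
    ∃ (Z : M) (i : X ⟶ Z) (p : Z ⟶ Y),
      i ≫ p = f ∧ cofibration i ∧ weakEquivalence i ∧ fibration p

/-- An object is fibrant if its map to the terminal object is a fibration. -/
def ModelStructure.Fibrant {M : Type u} [Category.{v} M] [HasLimits M] [HasColimits M]
    (S : ModelStructure M) (X : M) : Prop :=
  S.fibration (terminal.from X)

namespace HomotopicalAlgebra

variable {C : Type u} [Category.{v} C] [ModelCategory C]

attribute [local simp] pullback.lift_fst pullback.lift_snd
  pullback.lift_fst_assoc pullback.lift_snd_assoc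

lemma fibration_of_isPullback {X' Y' X Y : C} {t : X' ⟶ X} {p' : X' ⟶ Y'} {p : X ⟶ Y}
    {b : Y' ⟶ Y} (sq : IsPullback t p' p b) [Fibration p] : Fibration p' :=
  ⟨MorphismProperty.of_isPullback sq (mem_fibrations p)⟩

lemma weakEquivalence_of_isPullback {X' Y' X Y : C} {t : X' ⟶ X} {p' : X' ⟶ Y'} {p : X ⟶ Y}
    {b : Y' ⟶ Y} (sq : IsPullback t p' p b) [Fibration p] [WeakEquivalence p] :
    WeakEquivalence p' :=
  ⟨(MorphismProperty.of_isPullback sq (mem_trivialFibrations p)).2⟩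

/-- The base change of a section of a trivial fibration along a fibration is a
weak equivalence. -/
lemma weakEquivalence_of_isPullback_of_section {A Z E F : C} {i : A ⟶ Z} {r : Z ⟶ A}
    (hir : i ≫ r = 𝟙 A) [Fibration r] [WeakEquivalence r] {g : E ⟶ Z} [Fibration g]
    {j : F ⟶ E} {k : F ⟶ A} (h : IsPullback j k g i) : WeakEquivalence j := by
  -- `W` is a path object of `E` over `A`
  let fac := MorphismProperty.factorizationData (trivialCofibrations C) (fibrations C)
    (pullback.lift (𝟙 E) (𝟙 E) (by simp) : E ⟶ pullback (g ≫ r) (g ≫ r))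
  let W := fac.Z
  let c : E ⟶ W := fac.i
  let q : W ⟶ pullback (g ≫ r) (g ≫ r) := fac.p
  have hcq : c ≫ q = pullback.lift (𝟙 E) (𝟙 E) (by simp) := fac.fac
  have : WeakEquivalence c := inferInstanceAs (WeakEquivalence fac.i)
  have : Fibration q := inferInstanceAs (Fibration fac.p)
  let q₁ : W ⟶ E := q ≫ pullback.fst _ _
  let q₂ : W ⟶ E := q ≫ pullback.snd _ _
  have hc₁ : c ≫ q₁ = 𝟙 E := by simp [q₁, reassoc_of% hcq]
  have hc₂ : c ≫ q₂ = 𝟙 E := by simp [q₂, reassoc_of% hcq]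
  have hq : q₁ ≫ g ≫ r = q₂ ≫ g ≫ r := by
    simpa [q₁, q₂] using q ≫= (pullback.condition (f := g ≫ r) (g := g ≫ r))
  have : Fibration q₂ := inferInstanceAs (Fibration (q ≫ pullback.snd _ _))
  have : WeakEquivalence q₁ := weakEquivalence_of_precomp_of_fac hc₁
  have : WeakEquivalence q₂ := weakEquivalence_of_precomp_of_fac hc₂
  -- `W ⟶ E ×_A Z` is a trivial fibration
  let π : pullback (g ≫ r) (g ≫ r) ⟶ pullback (g ≫ r) r :=
    pullback.lift (pullback.fst _ _) (pullback.snd _ _ ≫ g) (by simp [pullback.condition])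
  have hπ : IsPullback (pullback.snd (g ≫ r) (g ≫ r)) π g (pullback.snd (g ≫ r) r) := by
    refine IsPullback.of_bot (v₂₁ := pullback.fst _ _) (v₂₂ := r) (h₃₁ := g ≫ r) ?_
      (by simp [π]) (IsPullback.of_hasPullback _ _).flip
    simpa [π] using (IsPullback.of_hasPullback (g ≫ r) (g ≫ r)).flip
  have : Fibration π := fibration_of_isPullback hπ
  have : WeakEquivalence (q ≫ π) :=
    weakEquivalence_of_postcomp_of_fac (g := pullback.fst (g ≫ r) r) (fg := q₁)
      (by simp [π, q₁])
  -- the part of `W` lying over `F` via `q₂`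
  let s : E ⟶ pullback (g ≫ r) r := pullback.lift (𝟙 E) (g ≫ r ≫ i) (by simp [hir])
  have hs : IsPullback (g ≫ r) s i (pullback.snd (g ≫ r) r) := by
    refine IsPullback.of_bot (v₂₁ := pullback.fst _ _) (v₂₂ := r) (h₃₁ := g ≫ r) ?_
      (by simp [s]) (IsPullback.of_hasPullback _ _).flip
    have : IsPullback (g ≫ r) (𝟙 E) (𝟙 A) (g ≫ r) := IsPullback.of_vert_isIso ⟨by simp⟩
    simpa [s, hir] using this
  have hW₀ : IsPullback (pullback.fst q₂ j) (pullback.snd q₂ j ≫ k) (q₂ ≫ g) i :=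
    (IsPullback.of_hasPullback q₂ j).paste_vert h
  have hW₁ : IsPullback (pullback.fst q₂ j) (pullback.fst q₂ j ≫ q₁) (q ≫ π) s := by
    have e : pullback.fst q₂ j ≫ q₂ ≫ g = pullback.snd q₂ j ≫ k ≫ i := by simpa using hW₀.w
    have e' : pullback.fst q₂ j ≫ q₁ ≫ g ≫ r = pullback.snd q₂ j ≫ k := by
      rw [hq, reassoc_of% e, hir, Category.comp_id]
    refine IsPullback.of_bot (v₂₁ := g ≫ r) (v₂₂ := pullback.snd (g ≫ r) r)
      (h₃₁ := i) ?_ ?_ hs.flip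
    · simpa [e', π, q₂] using hW₀
    · ext
      · simp [s, π, q₁]
      · simp [s, π, reassoc_of% e', ← e, q₂]
  have : WeakEquivalence (pullback.fst q₂ j ≫ q₁) := weakEquivalence_of_isPullback hW₁
  let d : F ⟶ pullback q₂ j := pullback.lift (j ≫ c) (𝟙 F) (by simp [hc₂])
  have : WeakEquivalence d :=
    weakEquivalence_of_postcomp_of_fac (g := pullback.snd q₂ j) (fg := 𝟙 F) (by simp [d])
  have hd : d ≫ pullback.fst q₂ j ≫ q₁ = j := by simp [d, hc₁]
  rw [← hd]
  infer_instance

/-- Base change along a fibration preserves weak equivalences between fibrant objects. -/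
lemma weakEquivalence_of_isPullback_of_isFibrant {A B E F : C} {w : A ⟶ B} [IsFibrant A]
    [IsFibrant B] [WeakEquivalence w] {g : E ⟶ B} [Fibration g]
    {j : F ⟶ E} {k : F ⟶ A} (h : IsPullback j k g w) : WeakEquivalence j := by
  let b : FibrantBrownFactorization w := Classical.arbitrary _
  have h₁ := IsPullback.of_hasPullback g b.p
  have : WeakEquivalence (pullback.fst g b.p) := weakEquivalence_of_isPullback h₁.flip
  have h₂ : IsPullback (pullback.lift j (k ≫ b.i) (by simpa using h.w)) k
      (pullback.snd g b.p) b.i :=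
    IsPullback.of_right (by simpa using h) (by simp) h₁
  have := weakEquivalence_of_isPullback_of_section b.i_r h₂
  rw [← pullback.lift_fst (f := g) (g := b.p) j (k ≫ b.i) (by simpa using h.w)]
  infer_instance

lemma isPullback_lift_snd {A B X Y : C} (t : A ⟶ B) {p : X ⟶ B} {q : Y ⟶ B} {v : X ⟶ Y}
    (hv : v ≫ q = p) :
    IsPullback (pullback.snd t p)
      (pullback.lift (pullback.fst t p) (pullback.snd t p ≫ v)
        (by simp [hv, pullback.condition]) : pullback t p ⟶ pullback t q) v (pullback.snd t q) := by
  refine IsPullback.of_bot (v₂₁ := pullback.fst _ _) (v₂₂ := q) (h₃₁ := t) ?_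
    (by simp) (IsPullback.of_hasPullback _ _).flip
  simpa [hv] using (IsPullback.of_hasPullback t p).flip

/-- Base change preserves weak equivalences between fibrations over a common base. -/
lemma weakEquivalence_pullback_lift_of_fibration {A B X Y : C} (t : A ⟶ B) {p : X ⟶ B} {q : Y ⟶ B}
    [Fibration p] [Fibration q] {v : X ⟶ Y} [WeakEquivalence v] (hv : v ≫ q = p) :
    WeakEquivalence (pullback.lift (pullback.fst t p) (pullback.snd t p ≫ v)
        (by simp [hv, pullback.condition]) : pullback t p ⟶ pullback t q) := by
  let fac := MorphismProperty.factorizationData (trivialCofibrations C) (fibrations C)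
    (pullback.lift (𝟙 X) v (by simp [hv]) : X ⟶ pullback p q)
  let W := fac.Z
  let c : X ⟶ W := fac.i
  let m : W ⟶ pullback p q := fac.p
  have hcm : c ≫ m = pullback.lift (𝟙 X) v (by simp [hv]) := fac.fac
  have : WeakEquivalence c := inferInstanceAs (WeakEquivalence fac.i)
  have : Fibration m := inferInstanceAs (Fibration fac.p)
  let m₁ : W ⟶ X := m ≫ pullback.fst _ _
  let m₂ : W ⟶ Y := m ≫ pullback.snd _ _
  have hc₁ : c ≫ m₁ = 𝟙 X := by simp [m₁, reassoc_of% hcm]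
  have hc₂ : c ≫ m₂ = v := by simp [m₂, reassoc_of% hcm]
  have hm : m₂ ≫ q = m₁ ≫ p := by simp [m₁, m₂, pullback.condition]
  have : Fibration m₁ := inferInstanceAs (Fibration (m ≫ pullback.fst _ _))
  have : Fibration m₂ := inferInstanceAs (Fibration (m ≫ pullback.snd _ _))
  have : WeakEquivalence m₁ := weakEquivalence_of_precomp_of_fac hc₁
  have : WeakEquivalence m₂ := weakEquivalence_of_precomp_of_fac hc₂
  have := weakEquivalence_of_isPullback (isPullback_lift_snd t (rfl : m₁ ≫ p = _))
  have := weakEquivalence_of_isPullback (isPullback_lift_snd t hm)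
  let c' : pullback t p ⟶ pullback t (m₁ ≫ p) :=
    pullback.lift (pullback.fst t p) (pullback.snd t p ≫ c)
      (by simp [reassoc_of% hc₁, pullback.condition])
  have hc' : c' ≫ (pullback.lift (pullback.fst t (m₁ ≫ p)) (pullback.snd t (m₁ ≫ p) ≫ m₁)
      (by simp [pullback.condition]) : _ ⟶ pullback t p) = 𝟙 _ := by
    ext <;> simp [c', hc₁]
  have : WeakEquivalence c' := weakEquivalence_of_postcomp_of_fac hc'
  have fac' : pullback.lift (pullback.fst t p) (pullback.snd t p ≫ v)
        (by simp [hv, pullback.condition]) =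
      c' ≫ (pullback.lift (pullback.fst t (m₁ ≫ p)) (pullback.snd t (m₁ ≫ p) ≫ m₂)
        (by simp [hm, pullback.condition]) : _ ⟶ pullback t q) := by
    ext <;> simp [c', hc₂]
  rw [fac']
  infer_instance

/-- The gluing lemma for pullbacks of fibrations between fibrant objects. -/
lemma weakEquivalence_pullback_map {Xa Xb Xc Xa' Xb' Xc' : C}
    (f : Xa ⟶ Xb) (g : Xc ⟶ Xb) (f' : Xa' ⟶ Xb') (g' : Xc' ⟶ Xb')
    [IsFibrant Xa] [IsFibrant Xb] [IsFibrant Xa'] [IsFibrant Xb']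
    [Fibration g] [Fibration g'] (ia : Xa ⟶ Xa') (ib : Xb ⟶ Xb') (ic : Xc ⟶ Xc')
    [WeakEquivalence ia] [WeakEquivalence ib] [WeakEquivalence ic]
    (sq₁ : f ≫ ib = ia ≫ f') (sq₂ : g ≫ ib = ic ≫ g') :
    WeakEquivalence (pullback.map f g f' g' ia ic ib sq₁ sq₂) := by
  have := weakEquivalence_of_isPullback_of_isFibrant (IsPullback.of_hasPullback ib g').flip
  let v : Xc ⟶ pullback ib g' := pullback.lift g ic sq₂
  have : WeakEquivalence v :=
    weakEquivalence_of_postcomp_of_fac (g := pullback.snd ib g') (fg := ic) (by simp [v])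
  have hv : v ≫ pullback.fst ib g' = g := by simp [v]
  have := weakEquivalence_pullback_lift_of_fibration f hv
  have h : IsPullback (pullback.snd f (pullback.fst ib g') ≫ pullback.snd ib g')
      (pullback.fst f (pullback.fst ib g')) g' (ia ≫ f') := by
    rw [← sq₁]
    exact (IsPullback.of_hasPullback f (pullback.fst ib g')).flip.paste_horiz
      (IsPullback.of_hasPullback ib g').flip
  let l : pullback f (pullback.fst ib g') ⟶ pullback f' g' :=
    pullback.lift (pullback.fst _ _ ≫ ia) (pullback.snd _ _ ≫ pullback.snd _ _)
      (by simpa using h.w.symm)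
  have hl : IsPullback l (pullback.fst f (pullback.fst ib g')) (pullback.fst f' g') ia :=
    IsPullback.of_right (by simpa [l] using h) (by simp [l])
      (IsPullback.of_hasPullback f' g').flip
  have : WeakEquivalence l := weakEquivalence_of_isPullback_of_isFibrant hl
  have e : pullback.map f g f' g' ia ic ib sq₁ sq₂ =
      pullback.lift (pullback.fst f g) (pullback.snd f g ≫ v)
        (by simp [hv, pullback.condition]) ≫ l := by
    ext <;> simp [l, v]
  rw [e]
  infer_instance

end HomotopicalAlgebra

open HomotopicalAlgebra in
/-- The `ModelCategory` structure given by a `ModelStructure`. -/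
@[reducible]
def ModelStructure.modelCategory {M : Type u} [Category.{v} M] [HasLimits M] [HasColimits M]
    (S : ModelStructure M) : ModelCategory M :=
  have isRetractOfArrow {X Y X' Y' : M} {f : X ⟶ Y} {g : X' ⟶ Y'} (h : RetractArrow f g) :
      IsRetractOfArrow f g :=
    ⟨h.i.left, h.i.right, h.r.left, h.r.right, h.retract_left, h.retract_right, h.i_w, h.r_w⟩
  { categoryWithFibrations := ⟨S.fibration⟩
    categoryWithCofibrations := ⟨S.cofibration⟩
    categoryWithWeakEquivalences := ⟨S.weakEquivalence⟩
    cm2 :=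
      { comp_mem := S.two_of_three_comp
        of_postcomp := S.two_of_three_left
        of_precomp := S.two_of_three_right }
    cm3a := ⟨fun h hg ↦ S.weakEquivalence_retract _ _ (isRetractOfArrow h) hg⟩
    cm3b := ⟨fun h hg ↦ S.fibration_retract _ _ (isRetractOfArrow h) hg⟩
    cm3c := ⟨fun h hg ↦ S.cofibration_retract _ _ (isRetractOfArrow h) hg⟩
    cm4a i p hi hw hp := S.lifting_trivCof_fib i p hi.mem hw.mem hp.mem
    cm4b i p hi hp hw := S.lifting_cof_trivFib i p hi.mem hp.mem hw.mem
    cm5a := ⟨fun f ↦ by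
      obtain ⟨Z, i, p, fac, hi, hw, hp⟩ := S.factorization_trivCof_fib f
      exact ⟨⟨Z, i, p, fac, ⟨hi, hw⟩, hp⟩⟩⟩
    cm5b := ⟨fun f ↦ by
      obtain ⟨Z, i, p, fac, hi, hp, hw⟩ := S.factorization_cof_trivFib f
      exact ⟨⟨Z, i, p, fac, hi, ⟨hp, hw⟩⟩⟩⟩ }

/-- Given a model category `M`, two cospans of fibrant objects in which the second legs are
fibrations, and a morphism of cospans consisting of weak equivalences, the induced morphism
on pullbacks is a weak equivalence. -/
theorem ModelStructure.pullback_map_weakEquivalence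
    {M : Type u} [Category.{v} M] [HasLimits M] [HasColimits M] (S : ModelStructure M)
    {Xa Xb Xc Xa' Xb' Xc' : M}
    (f : Xa ⟶ Xb) (g : Xc ⟶ Xb) (f' : Xa' ⟶ Xb') (g' : Xc' ⟶ Xb')
    (hXa : S.Fibrant Xa) (hXb : S.Fibrant Xb) (hXc : S.Fibrant Xc)
    (hXa' : S.Fibrant Xa') (hXb' : S.Fibrant Xb') (hXc' : S.Fibrant Xc')
    (hg : S.fibration g) (hg' : S.fibration g')
    (ia : Xa ⟶ Xa') (ib : Xb ⟶ Xb') (ic : Xc ⟶ Xc')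
    (wa : S.weakEquivalence ia) (wb : S.weakEquivalence ib) (wc : S.weakEquivalence ic)
    (sq₁ : f ≫ ib = ia ≫ f') (sq₂ : g ≫ ib = ic ≫ g') :
    S.weakEquivalence (pullback.map f g f' g' ia ic ib sq₁ sq₂) := by
  let := S.modelCategory
  have : HomotopicalAlgebra.IsFibrant Xa := ⟨hXa⟩
  have : HomotopicalAlgebra.IsFibrant Xb := ⟨hXb⟩
  have : HomotopicalAlgebra.IsFibrant Xa' := ⟨hXa'⟩
  have : HomotopicalAlgebra.IsFibrant Xb' := ⟨hXb'⟩
  have : HomotopicalAlgebra.Fibration g := ⟨hg⟩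
  have : HomotopicalAlgebra.Fibration g' := ⟨hg'⟩
  have : HomotopicalAlgebra.WeakEquivalence ia := ⟨wa⟩
  have : HomotopicalAlgebra.WeakEquivalence ib := ⟨wb⟩
  have : HomotopicalAlgebra.WeakEquivalence ic := ⟨wc⟩
  exact (HomotopicalAlgebra.weakEquivalence_pullback_map f g f' g' ia ib ic sq₁ sq₂).mem
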